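/- For every partition λ = (λ₁ ≥ λ₂ ≥ … ≥ λ_r ≥ 0) and every Θ' ∈ {Γ,Δ}^{r−1}, the map sh_{Θ'} : 𝔗 ↦ 𝔗 + ρ^{Θ'} is a bijection from GTP_λ onto GTP^{Θ'}_{λ+ρ}, where λ+ρ = (λ₁+r−1, λ₂+r−2, …, λ_r). -/

import Mathlib

namespace GTP

/-- Row-pair types: `Γ` (left-strict) and `Δ` (right-strict). -/
inductive GD | G | D
deriving DecidableEq

/-- A triangular array, encoded as a function `ℕ → ℕ → ℕ` vanishing outside the triangle,
is a Gelfand–Tsetlin pattern with `r` rows if the interlacing inequalities hold. -/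
def IsGTP (r : ℕ) (a : ℕ → ℕ → ℕ) : Prop :=
  (∀ i j, (j < i ∨ r ≤ j) → a i j = 0) ∧
  (∀ i j, 1 ≤ i → i ≤ j → j < r → a (i - 1) (j - 1) ≥ a i j ∧ a i j ≥ a (i - 1) j)

/-- The row-pair `(i−1, i)` is left-strict (type `Γ`). -/
def RowPairG (r : ℕ) (a : ℕ → ℕ → ℕ) (i : ℕ) : Prop :=
  ∀ j, i ≤ j → j < r → a (i - 1) (j - 1) > a i j ∧ a i j ≥ a (i - 1) j

/-- The row-pair `(i−1, i)` is right-strict (type `Δ`). -/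
def RowPairD (r : ℕ) (a : ℕ → ℕ → ℕ) (i : ℕ) : Prop :=
  ∀ j, i ≤ j → j < r → a (i - 1) (j - 1) ≥ a i j ∧ a i j > a (i - 1) j

/-- The set `GTP_μ` of Gelfand–Tsetlin patterns with top row `μ` (`0`-based:
`a 0 j = μ j`). -/
def setGTP (r : ℕ) (μ : ℕ → ℕ) : Set (ℕ → ℕ → ℕ) :=
  {a | IsGTP r a ∧ ∀ j, j < r → a 0 j = μ j}

/-- The set `GTP^{Θ'}_μ` of patterns in `GTP_μ` whose row-pair `(i−1, i)` has type `Θ'_i`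
for every `1 ≤ i ≤ r−1`. -/
def setGTPTyped (r : ℕ) (Θ' : ℕ → GD) (μ : ℕ → ℕ) : Set (ℕ → ℕ → ℕ) :=
  {a | IsGTP r a ∧ (∀ j, j < r → a 0 j = μ j) ∧
    ∀ i, 1 ≤ i → i < r →
      ((Θ' i = GD.G → RowPairG r a i) ∧ (Θ' i = GD.D → RowPairD r a i))}

/-- The minimal pattern `ρ^{Θ'}` (raw recursion on the row index). -/
def rhoRaw (r : ℕ) (Θ' : ℕ → GD) : ℕ → ℕ → ℕ
  | 0, j => r - 1 - j
  | i + 1, j =>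
      match Θ' (i + 1) with
      | GD.G => rhoRaw r Θ' i j
      | GD.D => rhoRaw r Θ' i (j - 1)

/-- The triangular array `ρ^{Θ'}`, vanishing outside the triangle. -/
def rhoArr (r : ℕ) (Θ' : ℕ → GD) (i j : ℕ) : ℕ :=
  if i ≤ j ∧ j < r then rhoRaw r Θ' i j else 0

/-- The shift map `sh_{Θ'} : 𝔗 ↦ 𝔗 + ρ^{Θ'}` (entrywise sum). -/
def shMap (r : ℕ) (Θ' : ℕ → GD) (a : ℕ → ℕ → ℕ) : ℕ → ℕ → ℕ :=
  fun i j => a i j + rhoArr r Θ' i j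

theorem rhoRaw_eq_succ_add_one (r : ℕ) (Θ' : ℕ → GD) (i j : ℕ) (hij : i ≤ j) (hj : j + 1 < r) :
    rhoRaw r Θ' i j = rhoRaw r Θ' i (j + 1) + 1 := by
  induction i generalizing j with
  | zero => simp only [rhoRaw]; omega
  | succ i ih =>
    obtain ⟨k, rfl⟩ : ∃ k, j = k + 1 := ⟨j - 1, by omega⟩
    cases h : Θ' (i + 1)
    · simpa only [rhoRaw, h] using ih (k + 1) (by omega) hj
    · simpa only [rhoRaw, h, Nat.add_sub_cancel] using ih k (by omega) (by omega)

theorem rhoArr_eq_succ_add_one (r : ℕ) (Θ' : ℕ → GD) (i j : ℕ) (hij : i ≤ j) (hj : j + 1 < r) :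
    rhoArr r Θ' i j = rhoArr r Θ' i (j + 1) + 1 := by
  rw [rhoArr, rhoArr, if_pos (by omega), if_pos (by omega)]
  exact rhoRaw_eq_succ_add_one r Θ' i j hij hj

theorem rhoArr_succ_of_G {r : ℕ} {Θ' : ℕ → GD} {i : ℕ} (h : Θ' (i + 1) = GD.G) (j : ℕ)
    (hij : i ≤ j) (hj : j + 1 < r) :
    rhoArr r Θ' (i + 1) (j + 1) = rhoArr r Θ' i (j + 1) := by
  rw [rhoArr, rhoArr, if_pos (by omega), if_pos (by omega)]
  simp only [rhoRaw, h]

theorem rhoArr_succ_of_D {r : ℕ} {Θ' : ℕ → GD} {i : ℕ} (h : Θ' (i + 1) = GD.D) (j : ℕ)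
    (hij : i ≤ j) (hj : j + 1 < r) :
    rhoArr r Θ' (i + 1) (j + 1) = rhoArr r Θ' i j := by
  rw [rhoArr, rhoArr, if_pos (by omega), if_pos (by omega)]
  simp only [rhoRaw, h, Nat.add_sub_cancel]

theorem rhoArr_zero_left (r : ℕ) (Θ' : ℕ → GD) (j : ℕ) (hj : j < r) :
    rhoArr r Θ' 0 j = r - 1 - j := by
  simp [rhoArr, rhoRaw, hj]

theorem rhoArr_eq_zero (r : ℕ) (Θ' : ℕ → GD) (i j : ℕ) (h : j < i ∨ r ≤ j) :
    rhoArr r Θ' i j = 0 :=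
  if_neg (by omega)

theorem shMap_injective (r : ℕ) (Θ' : ℕ → GD) : Function.Injective (shMap r Θ') :=
  fun _ _ h => funext₂ fun i j => Nat.add_right_cancel (congrFun₂ h i j)

/-- Adding `ρ^{Θ'}` turns the weak interlacing inequalities into those of type `Θ'`. -/
theorem shMap_mem_setGTPTyped_iff (r : ℕ) (lam : ℕ → ℕ) (Θ' : ℕ → GD) (a : ℕ → ℕ → ℕ) :
    shMap r Θ' a ∈ setGTPTyped r Θ' (fun j => lam j + (r - 1 - j)) ↔ a ∈ setGTP r lam := by
  simp only [setGTPTyped, setGTP, Set.mem_ofPred_eq, IsGTP, RowPairG, RowPairD, shMap]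
  constructor
  · rintro ⟨⟨hz, -⟩, h0, ht⟩
    refine ⟨⟨fun i j h => by have := hz i j h; omega, fun i j hi hij hj => ?_⟩, fun j hj => ?_⟩
    · obtain ⟨i, rfl⟩ : ∃ k, i = k + 1 := ⟨i - 1, by omega⟩
      obtain ⟨j, rfl⟩ : ∃ k, j = k + 1 := ⟨j - 1, by omega⟩
      have e := rhoArr_eq_succ_add_one r Θ' i j (by omega) hj
      have t := ht (i + 1) hi (by omega)
      simp only [Nat.add_sub_cancel] at t ⊢
      cases h : Θ' (i + 1)
      · have := rhoArr_succ_of_G h j (by omega) hj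
        have := t.1 h (j + 1) hij hj
        simp only [Nat.add_sub_cancel] at this
        omega
      · have := rhoArr_succ_of_D h j (by omega) hj
        have := t.2 h (j + 1) hij hj
        simp only [Nat.add_sub_cancel] at this
        omega
    · have := h0 j hj
      rw [rhoArr_zero_left r Θ' j hj] at this
      omega
  · rintro ⟨⟨hz, hi⟩, h0⟩
    have key : ∀ i j, i ≤ j → j + 1 < r →
        a i j ≥ a (i + 1) (j + 1) ∧ a (i + 1) (j + 1) ≥ a i (j + 1) :=
      fun i j hij hj => hi (i + 1) (j + 1) (by omega) (by omega) hj
    have typed : ∀ i, 1 ≤ i → i < r → (Θ' i = GD.G → RowPairG r (shMap r Θ' a) i) ∧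
        (Θ' i = GD.D → RowPairD r (shMap r Θ' a) i) := by
      intro i h1 _
      obtain ⟨i, rfl⟩ : ∃ k, i = k + 1 := ⟨i - 1, by omega⟩
      constructor <;> intro h j hij hj <;>
        obtain ⟨j, rfl⟩ : ∃ k, j = k + 1 := ⟨j - 1, by omega⟩ <;>
        have e := rhoArr_eq_succ_add_one r Θ' i j (by omega) hj <;>
        have := key i j (by omega) hj <;>
        simp only [Nat.add_sub_cancel, shMap]
      · have := rhoArr_succ_of_G h j (by omega) hj
        omega
      · have := rhoArr_succ_of_D h j (by omega) hj
        omega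
    refine ⟨⟨fun i j h => ?_, fun i j h1 hij hj => ?_⟩, fun j hj => ?_, typed⟩
    · rw [hz i j h, rhoArr_eq_zero r Θ' i j h]
    · cases h : Θ' i
      · exact ((typed i h1 (by omega)).1 h j hij hj).imp_left le_of_lt
      · exact ((typed i h1 (by omega)).2 h j hij hj).imp_right le_of_lt
    · rw [h0 j hj, rhoArr_zero_left r Θ' j hj]

/-- `ρ^{Θ'}` is a lower bound for every pattern of type `Θ'` with top row `λ + ρ`. -/
theorem rhoArr_le_of_mem_setGTPTyped {r : ℕ} {lam : ℕ → ℕ} {Θ' : ℕ → GD} {b : ℕ → ℕ → ℕ}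
    (hb : b ∈ setGTPTyped r Θ' (fun j => lam j + (r - 1 - j))) (i j : ℕ) :
    rhoArr r Θ' i j ≤ b i j := by
  obtain ⟨-, h0, ht⟩ := hb
  induction i generalizing j with
  | zero =>
    by_cases hj : j < r
    · rw [h0 j hj, rhoArr_zero_left r Θ' j hj]
      exact Nat.le_add_left _ _
    · rw [rhoArr_eq_zero r Θ' 0 j (by omega)]
      exact Nat.zero_le _
  | succ i ih =>
    by_cases h : j < i + 1 ∨ r ≤ j
    · rw [rhoArr_eq_zero r Θ' _ j h]
      exact Nat.zero_le _
    · obtain ⟨j, rfl⟩ : ∃ k, j = k + 1 := ⟨j - 1, by omega⟩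
      have hle := ih (j + 1)
      cases hΘ : Θ' (i + 1)
      · rw [rhoArr_succ_of_G hΘ j (by omega) (by omega)]
        exact hle.trans
          ((ht (i + 1) (by omega) (by omega)).1 hΘ (j + 1) (by omega) (by omega)).2
      · rw [rhoArr_succ_of_D hΘ j (by omega) (by omega),
          rhoArr_eq_succ_add_one r Θ' i j (by omega) (by omega)]
        exact (Nat.succ_le_succ hle).trans
          ((ht (i + 1) (by omega) (by omega)).2 hΘ (j + 1) (by omega) (by omega)).2

/-- For every partition `λ` and every `Θ' ∈ {Γ,Δ}^{r−1}`, the map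
`sh_{Θ'}` is a bijection from `GTP_λ` onto `GTP^{Θ'}_{λ+ρ}`. -/
theorem shMap_bijOn (r : ℕ) (hr : 1 ≤ r) (lam : ℕ → ℕ)
    (hlam : ∀ j k, j ≤ k → k < r → lam k ≤ lam j) (Θ' : ℕ → GD) :
    Set.BijOn (shMap r Θ') (setGTP r lam)
      (setGTPTyped r Θ' (fun j => lam j + (r - 1 - j))) := by
  refine ⟨fun a ha => (shMap_mem_setGTPTyped_iff r lam Θ' a).2 ha,
    (shMap_injective r Θ').injOn, fun b hb => ?_⟩
  have hsub : shMap r Θ' (fun i j => b i j - rhoArr r Θ' i j) = b :=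
    funext₂ fun i j => Nat.sub_add_cancel (rhoArr_le_of_mem_setGTPTyped hb i j)
  exact ⟨_, (shMap_mem_setGTPTyped_iff r lam Θ' _).1 (hsub.symm ▸ hb), hsub⟩

end GTP
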